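/- Let G be a finite simple graph in which every vertex has degree exactly 3, with n = |V(G)| = 2^m for some m ≥ 1, let k be an integer with 1 < k < n−1, and let G' (with weights, β, α and k' as specified) be the associated gadget graph. If G' has a treedepth decomposition of weighted depth at most k' = 3n + k + α + 2, then G has a vertex cover of size at most k. -/

import Mathlib

/-- A treedepth decomposition of a simple graph `G`: a partial order `le` on the
vertices such that the set of elements below any vertex is linearly ordered, and
the endpoints of every edge are comparable. -/
structure TDDecomp {V : Type*} (G : SimpleGraph V) where
  le : V → V → Prop
  le_refl : ∀ x, le x x
  le_antisymm : ∀ x y, le x y → le y x → x = y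
  le_trans : ∀ x y z, le x y → le y z → le x z
  down_linear : ∀ x y z, le y x → le z x → le y z ∨ le z y
  adj_comparable : ∀ u v, G.Adj u v → le u v ∨ le v u

/-- A chain of a treedepth decomposition: a finite set of pairwise comparable vertices. -/
def TDDecomp.IsChain {V : Type*} {G : SimpleGraph V} (T : TDDecomp G) (C : Finset V) : Prop :=
  ∀ x ∈ C, ∀ y ∈ C, T.le x y ∨ T.le y x

/-- The weighted depth of a treedepth decomposition: the maximum over all chains `C`
of the total weight of `C`. -/
noncomputable def TDDecomp.weightedDepth {V : Type*} {G : SimpleGraph V}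
    (T : TDDecomp G) (w : V → ℕ) : ℕ :=
  sSup {s | ∃ C : Finset V, T.IsChain C ∧ s = C.sum w}

/-- The weighted treedepth of `G` with weight function `w`: the minimum weighted depth
over all treedepth decompositions of `G`. -/
noncomputable def wtd {V : Type*} (G : SimpleGraph V) (w : V → ℕ) : ℕ :=
  sInf {s | ∃ T : TDDecomp G, s = T.weightedDepth w}

/-- Vertices of the gadget graph `G'` built from a cubic graph `G` on `2^m` vertices:
`copy v i` is `v_{i+1}` (the two copies `v_1, v_2` of `v`), `guard v i` is `v_{g(i+1)}`
(the three vertices `v_{g1}, v_{g2}, v_{g3}`), and `tree t i j` is the `j`-th vertex at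
depth `i` of the complete binary tree `T_{t+1}` (depth `m` vertices are the `2^m` leaves). -/
inductive GadgetV (V : Type*) (m : ℕ) where
  | copy : V → Fin 2 → GadgetV V m
  | guard : V → Fin 3 → GadgetV V m
  | tree : Fin 3 → (i : Fin (m + 1)) → Fin (2 ^ i.val) → GadgetV V m

/-- The base relation generating the edges of `G'` (for `e : V ≃ Fin (2^m)` the
identification of `V(G)` with the leaves of each tree):
copies of adjacent vertices are adjacent (`u_1v_1, u_2v_2, u_1v_2, u_2v_1`);
each `v_{gi}` is adjacent to `v_1` and `v_2`; consecutive levels of each complete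
binary tree `T_t` are joined (child `j'` at depth `i+1` to parent `j'/2` at depth `i`);
and `v_1, v_{g1}` are joined to the leaf `v_{t_1}` of `T_1`, `v_2, v_{g2}` to the leaf
`v_{t_2}` of `T_2`, and `v_{g3}` to the leaf `v_{t_3}` of `T_3`. -/
def gadgetRel {V : Type*} {m : ℕ} (G : SimpleGraph V) (e : V ≃ Fin (2 ^ m)) :
    GadgetV V m → GadgetV V m → Prop
  | .copy u _, .copy v _ => G.Adj u v
  | .copy u _, .guard v _ => u = v
  | .copy u i, .tree t d j => (t : ℕ) = (i : ℕ) ∧ (d : ℕ) = m ∧ (j : ℕ) = (e u : ℕ)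
  | .guard u i, .tree t d j => (t : ℕ) = (i : ℕ) ∧ (d : ℕ) = m ∧ (j : ℕ) = (e u : ℕ)
  | .tree t d j, .tree t' d' j' => t = t' ∧ (d : ℕ) + 1 = (d' : ℕ) ∧ (j' : ℕ) / 2 = (j : ℕ)
  | _, _ => False

/-- The gadget graph `G'`. -/
def gadget {V : Type*} {m : ℕ} (G : SimpleGraph V) (e : V ≃ Fin (2 ^ m)) :
    SimpleGraph (GadgetV V m) :=
  SimpleGraph.fromRel (gadgetRel G e)

/-- The weight function of `G'` (with parameter `β`): copies `v_1, v_2` have weight `2`,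
the `v_{gi}` have weight `1`, and a tree vertex at depth `i` has weight `β + 3i`. -/
def gadgetW {V : Type*} {m : ℕ} (β : ℕ) : GadgetV V m → ℕ
  | .copy _ _ => 2
  | .guard _ _ => 1
  | .tree _ i _ => β + 3 * (i : ℕ)


namespace TDDecomp

variable {W : Type*} {G : SimpleGraph W} (T : TDDecomp G)

/-- Two vertices are comparable in a treedepth decomposition. -/
def Comp (x y : W) : Prop := T.le x y ∨ T.le y x

/-- `y` is the least element of the set `S`. -/
def IsMin (S : Set W) (y : W) : Prop := y ∈ S ∧ ∀ z ∈ S, T.le y z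

variable {T}

theorem Comp.symm {x y : W} (h : T.Comp x y) : T.Comp y x := Or.symm h

theorem comp_of_le_of_comp {r x z : W} (hr : T.le r z) (h : T.Comp x z) : T.Comp x r := by
  rcases h with h | h
  · exact T.down_linear _ _ _ h hr
  · exact Or.inr (T.le_trans _ _ _ hr h)

theorem exists_isMin_union {A B : Set W} {p q a b : W} (hp : T.IsMin A p) (hq : T.IsMin B q)
    (ha : a ∈ A) (hb : b ∈ B) (hab : T.Comp a b) : ∃ y, T.IsMin (A ∪ B) y := by
  have h1 : T.Comp a q := comp_of_le_of_comp (hq.2 b hb) hab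
  rcases comp_of_le_of_comp (hp.2 a ha) h1.symm with h | h
  · refine ⟨q, Or.inr hq.1, ?_⟩
    rintro z (hz | hz)
    · exact T.le_trans _ _ _ h (hp.2 z hz)
    · exact hq.2 z hz
  · refine ⟨p, Or.inl hp.1, ?_⟩
    rintro z (hz | hz)
    · exact hp.2 z hz
    · exact T.le_trans _ _ _ h (hq.2 z hz)

theorem exists_isMin_insert {A : Set W} {p a x : W} (hp : T.IsMin A p) (ha : a ∈ A)
    (hax : T.Comp x a) : ∃ y, T.IsMin (insert x A) y := by
  have hx : T.IsMin {x} x := ⟨rfl, by rintro z rfl; exact T.le_refl _⟩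
  exact exists_isMin_union hx hp rfl ha hax

/-- Some chain inside `S` has weight at least `s`. -/
def HasChain (T : TDDecomp G) (w : W → ℕ) (S : Set W) (s : ℕ) : Prop :=
  ∃ C : Finset W, T.IsChain C ∧ (∀ z ∈ C, z ∈ S) ∧ s ≤ C.sum w

theorem HasChain.insert_min {w : W → ℕ} {S S' : Set W} {s s' : ℕ} {y : W}
    (h : T.HasChain w S s) (hS : S ⊆ S') (hy : T.IsMin S' y) (hyS : y ∉ S)
    (hs : s' ≤ w y + s) : T.HasChain w S' s' := by
  classical
  obtain ⟨C, hC, hCS, hsum⟩ := h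
  refine ⟨insert y C, ?_, ?_, ?_⟩
  · intro a ha b hb
    rcases Finset.mem_insert.1 ha with rfl | ha'
    · rcases Finset.mem_insert.1 hb with rfl | hb'
      · exact Or.inl (T.le_refl _)
      · exact Or.inl (hy.2 b (hS (hCS b hb')))
    · rcases Finset.mem_insert.1 hb with rfl | hb'
      · exact Or.inr (hy.2 a (hS (hCS a ha')))
      · exact hC a ha' b hb'
  · intro z hz
    rcases Finset.mem_insert.1 hz with rfl | hz
    · exact hy.1
    · exact hS (hCS z hz)
  · rw [Finset.sum_insert (fun h => hyS (hCS y h))]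
    exact hs.trans (Nat.add_le_add_left hsum _)

theorem sum_le_weightedDepth [Finite W] (w : W → ℕ) {C : Finset W} (hC : T.IsChain C) :
    C.sum w ≤ T.weightedDepth w := by
  have := Fintype.ofFinite W
  refine le_csSup ⟨∑ x, w x, ?_⟩ ⟨C, hC, rfl⟩
  rintro s ⟨D, -, rfl⟩
  exact Finset.sum_le_sum_of_subset (Finset.subset_univ D)

end TDDecomp

namespace GadgetV

variable {V : Type*} {m : ℕ}

instance [Finite V] : Finite (GadgetV V m) := by
  let f : (V × Fin 2) ⊕ (V × Fin 3) ⊕ (Fin 3 × Σ i : Fin (m + 1), Fin (2 ^ i.val)) →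
      GadgetV V m
    | .inl p => .copy p.1 p.2
    | .inr (.inl p) => .guard p.1 p.2
    | .inr (.inr p) => .tree p.1 p.2.1 p.2.2
  refine Finite.of_surjective f ?_
  rintro (⟨v, i⟩ | ⟨v, i⟩ | ⟨t, i, j⟩)
  · exact ⟨.inl (v, i), rfl⟩
  · exact ⟨.inr (.inl (v, i)), rfl⟩
  · exact ⟨.inr (.inr (t, ⟨i, j⟩)), rfl⟩

/-- The tree vertices of `T_{t+1}` below (and including) the `j`-th vertex at depth `d`. -/
def subtree (V : Type*) (m : ℕ) (t : Fin 3) (d j : ℕ) : Set (GadgetV V m) :=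
  {x | ∃ (d' : Fin (m + 1)) (j' : Fin (2 ^ d'.val)),
    x = .tree t d' j' ∧ d ≤ d' ∧ j'.val / 2 ^ (d'.val - d) = j}

theorem tree_mem_subtree (t : Fin 3) {d j : ℕ} (hd : d < m + 1) (hj : j < 2 ^ d) :
    (.tree t ⟨d, hd⟩ ⟨j, hj⟩ : GadgetV V m) ∈ subtree V m t d j :=
  ⟨_, _, rfl, le_rfl, by simp⟩

theorem tree_mem_subtree_zero (t : Fin 3) (d : Fin (m + 1)) (j : Fin (2 ^ d.val)) :
    (.tree t d j : GadgetV V m) ∈ subtree V m t 0 0 :=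
  ⟨_, _, rfl, Nat.zero_le _, Nat.div_eq_of_lt (by simp)⟩

theorem subtree_child_subset {t : Fin 3} {d j c : ℕ} (hc : c / 2 = j) :
    subtree V m t (d + 1) c ⊆ subtree V m t d j := by
  rintro x ⟨d', j', rfl, hd, hj⟩
  refine ⟨d', j', rfl, by omega, ?_⟩
  rw [← hc, ← hj, Nat.div_div_eq_div_mul, ← pow_succ]
  congr 2
  omega

theorem tree_notMem_child {t : Fin 3} {d j c : ℕ} (hd : d < m + 1) (hj : j < 2 ^ d) :
    (.tree t ⟨d, hd⟩ ⟨j, hj⟩ : GadgetV V m) ∉ subtree V m t (d + 1) c := by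
  rintro ⟨d', j', h, hd', -⟩
  injection h with _ h
  subst h
  simp at hd'

theorem eq_of_mem_subtree {t t' : Fin 3} {d j j' : ℕ} {x : GadgetV V m}
    (h : x ∈ subtree V m t d j) (h' : x ∈ subtree V m t' d j') : t = t' ∧ j = j' := by
  obtain ⟨a, b, rfl, -, hj⟩ := h
  obtain ⟨a', b', h, -, hj'⟩ := h'
  injection h with ht ha hb
  subst ha
  obtain rfl := eq_of_heq hb
  exact ⟨ht, hj ▸ hj'⟩

theorem subtree_eq {t : Fin 3} {d j : ℕ} (hd : d < m + 1) (hj : j < 2 ^ d) {c c' : ℕ}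
    (hc : c / 2 = j) (hc' : c' / 2 = j) (hcc : c ≠ c') :
    subtree V m t d j = insert (.tree t ⟨d, hd⟩ ⟨j, hj⟩)
      (subtree V m t (d + 1) c ∪ subtree V m t (d + 1) c') := by
  apply Set.Subset.antisymm
  · rintro x ⟨d', j', rfl, hd', hj'⟩
    rcases hd'.eq_or_lt with rfl | hlt
    · left
      simp only [Nat.sub_self, pow_zero, Nat.div_one] at hj'
      subst hj'
      rfl
    · right
      have h2 : j'.val / 2 ^ (d'.val - (d + 1)) / 2 = j := by
        rw [← hj', Nat.div_div_eq_div_mul, ← pow_succ]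
        congr 2
        omega
      have : j'.val / 2 ^ (d'.val - (d + 1)) = c ∨ j'.val / 2 ^ (d'.val - (d + 1)) = c' := by
        omega
      rcases this with h | h
      · exact Or.inl ⟨d', j', rfl, hlt, h⟩
      · exact Or.inr ⟨d', j', rfl, hlt, h⟩
  · apply Set.insert_subset (tree_mem_subtree t hd hj)
    exact Set.union_subset (subtree_child_subset hc) (subtree_child_subset hc')

theorem le_gadgetW_of_mem_subtree {t : Fin 3} {d j : ℕ} (β : ℕ) {x : GadgetV V m}
    (h : x ∈ subtree V m t d j) : β + 3 * d ≤ gadgetW β x := by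
  obtain ⟨a, b, rfl, h, -⟩ := h
  simp only [gadgetW]
  omega

end GadgetV

open GadgetV

section Gadget

open Finset

variable {V : Type*} {m : ℕ} {G : SimpleGraph V} {e : V ≃ Fin (2 ^ m)}

theorem gadget_adj_of_rel {x y : GadgetV V m} (hne : x ≠ y) (h : gadgetRel G e x y) :
    (gadget G e).Adj x y :=
  (SimpleGraph.fromRel_adj _ _ _).2 ⟨hne, Or.inl h⟩

variable (T : TDDecomp (gadget G e))


theorem comp_tree_child (t : Fin 3) {d j c : ℕ} (hd : d + 1 < m + 1) (hj : j < 2 ^ d)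
    (hc : c < 2 ^ (d + 1)) (hcj : c / 2 = j) :
    T.Comp (.tree t ⟨d, by omega⟩ ⟨j, hj⟩) (.tree t ⟨d + 1, hd⟩ ⟨c, hc⟩) := by
  apply T.adj_comparable
  apply gadget_adj_of_rel
  · intro h
    injection h with _ h
    simp at h
  · exact ⟨rfl, rfl, hcj⟩

theorem exists_isMin_subtree (t : Fin 3) (h : ℕ) : ∀ d j : ℕ, d + h = m → j < 2 ^ d →
    ∃ y, T.IsMin (subtree V m t d j) y := by
  induction h with
  | zero =>
    intro d j hd hj
    refine ⟨.tree t ⟨d, by omega⟩ ⟨j, hj⟩, tree_mem_subtree t _ hj, ?_⟩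
    rintro z ⟨d', j', rfl, hd', hj'⟩
    obtain rfl : d = d' := by omega
    simp only [Nat.sub_self, pow_zero, Nat.div_one] at hj'
    subst hj'
    exact T.le_refl _
  | succ h ih =>
    intro d j hd hj
    have hp : 2 ^ (d + 1) = 2 * 2 ^ d := by ring
    have hl : 2 * j < 2 ^ (d + 1) := by omega
    have hr : 2 * j + 1 < 2 ^ (d + 1) := by omega
    obtain ⟨p, hpm⟩ := ih (d + 1) (2 * j) (by omega) hl
    obtain ⟨q, hqm⟩ := ih (d + 1) (2 * j + 1) (by omega) hr
    obtain ⟨y, hy⟩ := TDDecomp.exists_isMin_insert hpm (tree_mem_subtree t (by omega) hl)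
      (comp_tree_child T t (by omega) hj hl (by omega))
    obtain ⟨y', hy'⟩ := TDDecomp.exists_isMin_union hy hqm (Or.inl rfl)
      (tree_mem_subtree t (by omega) hr) (comp_tree_child T t (by omega) hj hr (by omega))
    rw [Set.insert_union] at hy'
    refine ⟨y', ?_⟩
    rwa [subtree_eq (by omega) hj (c := 2 * j) (c' := 2 * j + 1) (by omega) (by omega) (by omega)]

theorem sum_Ico_eq_add (β : ℕ) {d : ℕ} (hd : d < m + 1) :
    ∑ i ∈ Ico d (m + 1), (β + 3 * i) = β + 3 * d + ∑ i ∈ Ico (d + 1) (m + 1), (β + 3 * i) :=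
  Finset.sum_eq_sum_Ico_succ_bot hd _

theorem hasChain_subtree (β : ℕ) (t : Fin 3) (h : ℕ) : ∀ d j : ℕ, d + h = m → j < 2 ^ d →
    T.HasChain (gadgetW β) (subtree V m t d j) (∑ i ∈ Ico d (m + 1), (β + 3 * i)) := by
  induction h with
  | zero =>
    intro d j hd hj
    obtain rfl : d = m := by omega
    refine ⟨{.tree t ⟨d, by omega⟩ ⟨j, hj⟩}, ?_, ?_, ?_⟩
    · intro x hx y hy
      rw [Finset.mem_singleton.1 hx, Finset.mem_singleton.1 hy]
      exact Or.inl (T.le_refl _)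
    · intro z hz
      rw [Finset.mem_singleton.1 hz]
      exact tree_mem_subtree t _ hj
    · simp [gadgetW]
  | succ h ih =>
    intro d j hd hj
    have hp : 2 ^ (d + 1) = 2 * 2 ^ d := by ring
    obtain ⟨y, hy⟩ := exists_isMin_subtree T t (h + 1) d j hd hj
    obtain ⟨c, hcj, hyc⟩ : ∃ c, c / 2 = j ∧ y ∉ subtree V m t (d + 1) c := by
      by_cases hl : y ∈ subtree V m t (d + 1) (2 * j)
      · refine ⟨2 * j + 1, by omega, fun hr => ?_⟩
        have := (eq_of_mem_subtree hl hr).2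
        omega
      · exact ⟨2 * j, by omega, hl⟩
    refine (ih (d + 1) c (by omega) (by omega)).insert_min (subtree_child_subset hcj) hy hyc ?_
    rw [sum_Ico_eq_add β (by omega)]
    have := le_gadgetW_of_mem_subtree β hy.1
    omega

theorem hasChain_insert_subtree (β : ℕ) (t : Fin 3) {l : ℕ} (hl : l < 2 ^ m) {x : GadgetV V m}
    (hx : x ∉ subtree V m t 0 0) (hw : gadgetW β x ≤ 3)
    (hxl : T.Comp x (.tree t ⟨m, by omega⟩ ⟨l, hl⟩)) (h : ℕ) : ∀ d : ℕ, d + h = m →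
    T.HasChain (gadgetW β) (insert x (subtree V m t d (l / 2 ^ h)))
      (∑ i ∈ Ico d (m + 1), (β + 3 * i) + gadgetW β x) := by
  classical
  have hx' : ∀ d j, x ∉ subtree V m t d j := by
    rintro d j ⟨d', j', rfl, -⟩
    exact hx (tree_mem_subtree_zero _ _ _)
  induction h with
  | zero =>
    intro d hd
    obtain rfl : d = m := by omega
    have hne : x ≠ .tree t ⟨d, by omega⟩ ⟨l, hl⟩ :=
      fun h => hx (h ▸ tree_mem_subtree_zero _ _ _)
    refine ⟨{x, .tree t ⟨d, by omega⟩ ⟨l, hl⟩}, ?_, ?_, ?_⟩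
    · intro a ha b hb
      rw [Finset.mem_insert, Finset.mem_singleton] at ha hb
      rcases ha with rfl | rfl <;> rcases hb with rfl | rfl
      · exact Or.inl (T.le_refl _)
      · exact hxl
      · exact hxl.symm
      · exact Or.inl (T.le_refl _)
    · intro z hz
      rw [Finset.mem_insert, Finset.mem_singleton] at hz
      rcases hz with rfl | rfl
      · exact Or.inl rfl
      · right
        simpa using tree_mem_subtree (V := V) t (Nat.lt_succ_self d) hl
    · rw [Finset.sum_pair hne]
      simp only [Nat.Ico_succ_singleton, Finset.sum_singleton]
      simp only [gadgetW]
      omega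
  | succ h ih =>
    intro d hd
    have hpow : 2 ^ m = 2 ^ d * 2 ^ (h + 1) := by rw [← hd, pow_add]
    have hp : 2 ^ (d + 1) = 2 * 2 ^ d := by ring
    have hcj : l / 2 ^ h / 2 = l / 2 ^ (h + 1) := by
      rw [Nat.div_div_eq_div_mul, ← pow_succ]
    have hj : l / 2 ^ (h + 1) < 2 ^ d := Nat.div_lt_of_lt_mul (by rw [mul_comm, ← hpow]; exact hl)
    set c := l / 2 ^ h
    set j := l / 2 ^ (h + 1)
    have hmem : (.tree t ⟨m, by omega⟩ ⟨l, hl⟩ : GadgetV V m) ∈ subtree V m t d j :=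
      ⟨_, _, rfl, by simp; omega, by
        have : m - d = h + 1 := by omega
        simp [this, j]⟩
    obtain ⟨p, hpm⟩ := exists_isMin_subtree T t (h + 1) d j hd hj
    obtain ⟨y, hy⟩ := TDDecomp.exists_isMin_insert hpm hmem hxl
    rcases hy.1 with rfl | hyj
    · refine (hasChain_subtree T β t (h + 1) d j hd hj).insert_min (Set.subset_insert _ _) hy
        (hx' _ _) ?_
      omega
    have hyx : y ≠ x := by
      rintro rfl
      exact hx' _ _ hyj
    have hyw := le_gadgetW_of_mem_subtree β hyj
    by_cases hyc : y ∈ subtree V m t (d + 1) c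
    · obtain ⟨c', hc'j, hcc⟩ : ∃ c', c' / 2 = j ∧ c ≠ c' := by
        rcases Nat.even_or_odd' c with ⟨q, hq | hq⟩
        · exact ⟨c + 1, by omega, by omega⟩
        · exact ⟨c - 1, by omega, by omega⟩
      refine (hasChain_subtree T β t h (d + 1) c' (by omega) (by omega)).insert_min
        ((subtree_child_subset hc'j).trans (Set.subset_insert _ _)) hy
        (fun hyc' => hcc (eq_of_mem_subtree hyc hyc').2) ?_
      have := le_gadgetW_of_mem_subtree β hyc
      rw [sum_Ico_eq_add β (by omega)]
      omega
    · refine (ih (d + 1) (by omega)).insert_min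
        (Set.insert_subset_insert (subtree_child_subset hcj)) hy ?_ ?_
      · rintro (h | h)
        · exact hyx h
        · exact hyc h
      · rw [sum_Ico_eq_add β (by omega)]
        omega

open Classical in
/-- The weight of the part of the gadget of `v` that satisfies `P`. -/
noncomputable def localWeight (P : GadgetV V m → Prop) (v : V) : ℕ :=
  (if P (.copy v 0) then 2 else 0) + (if P (.copy v 1) then 2 else 0) +
    ((if P (.guard v 0) then 1 else 0) + (if P (.guard v 1) then 1 else 0) +
      (if P (.guard v 2) then 1 else 0))

open Classical in
theorem localWeight_eq (P : GadgetV V m → Prop) (v : V) {i o : Fin 2} (hio : i ≠ o) :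
    localWeight P v = (if P (.copy v i) then 2 else 0) + (if P (.copy v o) then 2 else 0) +
      ((if P (.guard v i.castSucc) then 1 else 0) + (if P (.guard v o.castSucc) then 1 else 0) +
        (if P (.guard v 2) then 1 else 0)) := by
  fin_cases i <;> fin_cases o
  · exact absurd rfl hio
  · rfl
  · rw [localWeight, add_comm (if P (.copy v 0) then 2 else 0),
      add_comm (if P (.guard v 0) then 1 else 0)]
    rfl
  · exact absurd rfl hio

open Classical in
theorem sum_localWeight_add_le [Fintype V] (β : ℕ) (P : GadgetV V m → Prop)
    {C : Finset (GadgetV V m)} (hC : T.IsChain C) (hPP : ∀ x y, P x → P y → T.Comp x y)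
    (hPC : ∀ x, P x → ∀ z ∈ C, T.Comp x z)
    (hdisj : ∀ z ∈ C, P z → ∃ t d j, z = .tree t d j) :
    ∑ v, localWeight P v + C.sum (gadgetW β) ≤ T.weightedDepth (gadgetW β) := by
  let g : V → Finset (GadgetV V m) := fun v =>
    {.copy v 0, .copy v 1, .guard v 0, .guard v 1, .guard v 2}
  let S : Finset (GadgetV V m) := univ.biUnion fun v => (g v).filter P
  have hg : ∀ v, ∀ x ∈ g v, (∃ i, x = .copy v i) ∨ ∃ i, x = .guard v i := by
    intro v x hx
    simp only [g, Finset.mem_insert, Finset.mem_singleton] at hx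
    rcases hx with rfl | rfl | rfl | rfl | rfl <;> simp
  have hSP : ∀ x ∈ S, P x ∧ ∃ v, x ∈ g v := by
    intro x hx
    obtain ⟨v, -, hx⟩ := Finset.mem_biUnion.1 hx
    exact ⟨(Finset.mem_filter.1 hx).2, v, (Finset.mem_filter.1 hx).1⟩
  have hS : S.sum (gadgetW β) = ∑ v, localWeight P v := by
    rw [Finset.sum_biUnion]
    · refine Finset.sum_congr rfl fun v _ => ?_
      simp only [g, Finset.sum_filter]
      rw [Finset.sum_insert (by simp), Finset.sum_insert (by simp), Finset.sum_insert (by simp),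
        Finset.sum_insert (by simp), Finset.sum_singleton]
      simp only [gadgetW, localWeight]
      omega
    · intro u _ v _ huv
      refine Finset.disjoint_left.2 fun x hx hx' => huv ?_
      rcases hg u x (Finset.mem_filter.1 hx).1 with ⟨i, rfl⟩ | ⟨i, rfl⟩ <;>
      rcases hg v _ (Finset.mem_filter.1 hx').1 with ⟨j, h⟩ | ⟨j, h⟩ <;>
      simp_all
  have hSC : Disjoint S C := by
    refine Finset.disjoint_left.2 fun x hx hx' => ?_
    obtain ⟨hP, v, hv⟩ := hSP x hx
    obtain ⟨t, d, j, rfl⟩ := hdisj x hx' hP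
    rcases hg v _ hv with ⟨i, h⟩ | ⟨i, h⟩ <;> cases h
  rw [← hS, ← Finset.sum_union hSC]
  refine TDDecomp.sum_le_weightedDepth _ fun x hx y hy => ?_
  rcases Finset.mem_union.1 hx with hx | hx <;> rcases Finset.mem_union.1 hy with hy | hy
  · exact hPP x y (hSP x hx).1 (hSP y hy).1
  · exact hPC x (hSP x hx).1 y hy
  · exact (hPC y (hSP y hy).1 x hx).symm
  · exact hC x hx y hy

variable {T}

theorem sum_localWeight_add_sum_le [Fintype V] (β : ℕ) {t : Fin 3} {r : GadgetV V m}
    (hr : T.IsMin (subtree V m t 0 0) r) {P : GadgetV V m → Prop} (hP : ∀ x, P x → T.le x r) :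
    ∑ v, localWeight P v + ∑ i ∈ range (m + 1), (β + 3 * i) ≤ T.weightedDepth (gadgetW β) := by
  obtain ⟨C, hC, hCS, hsum⟩ := hasChain_subtree T β t m 0 0 (by omega) (by simp)
  rw [← Finset.range_eq_Ico] at hsum
  refine (Nat.add_le_add_left hsum _).trans (sum_localWeight_add_le T β P hC ?_ ?_ ?_)
  · exact fun x y hx hy => T.down_linear _ _ _ (hP x hx) (hP y hy)
  · exact fun x hx z hz => Or.inl (T.le_trans _ _ _ (hP x hx) (hr.2 z (hCS z hz)))
  · intro z hz _
    obtain ⟨d, j, rfl, -⟩ := hCS z hz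
    exact ⟨_, _, _, rfl⟩

theorem sum_localWeight_add_sum_add_le [Fintype V] (β : ℕ) {t : Fin 3} {r : GadgetV V m}
    (hr : T.IsMin (subtree V m t 0 0) r) {P : GadgetV V m → Prop} (hP : ∀ x, P x → T.le x r)
    {l : ℕ} (hl : l < 2 ^ m) {x : GadgetV V m} (hx : x ∉ subtree V m t 0 0) (hxP : ¬ P x)
    (hw : gadgetW β x ≤ 3) (hxl : T.Comp x (.tree t ⟨m, by omega⟩ ⟨l, hl⟩)) :
    ∑ v, localWeight P v + (∑ i ∈ range (m + 1), (β + 3 * i) + gadgetW β x) ≤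
      T.weightedDepth (gadgetW β) := by
  obtain ⟨C, hC, hCS, hsum⟩ := hasChain_insert_subtree T β t hl hx hw hxl m 0 (by omega)
  rw [← Finset.range_eq_Ico] at hsum
  rw [Nat.div_eq_of_lt hl] at hCS
  refine (Nat.add_le_add_left hsum _).trans (sum_localWeight_add_le T β P hC ?_ ?_ ?_)
  · exact fun x y hx hy => T.down_linear _ _ _ (hP x hx) (hP y hy)
  · intro y hy z hz
    rcases hCS z hz with rfl | hz
    · have hyl := T.le_trans _ _ _ (hP y hy)
        (hr.2 _ (tree_mem_subtree_zero _ ⟨m, by omega⟩ ⟨l, hl⟩))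
      exact (TDDecomp.comp_of_le_of_comp hyl hxl).symm
    · exact Or.inl (T.le_trans _ _ _ (hP y hy) (hr.2 z hz))
  · intro z hz hzP
    rcases hCS z hz with rfl | ⟨d, j, rfl, -⟩
    · exact absurd hzP hxP
    · exact ⟨_, _, _, rfl⟩

theorem not_le_of_isMin_subtree [Finite V] (β : ℕ) {s t : Fin 3} (hst : s ≠ t)
    {p q : GadgetV V m} (hp : T.IsMin (subtree V m s 0 0) p) (hq : T.IsMin (subtree V m t 0 0) q)
    (hT : T.weightedDepth (gadgetW β) < β + ∑ i ∈ range (m + 1), (β + 3 * i)) :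
    ¬ T.le p q := by
  intro hpq
  have hmin : T.IsMin (insert p (subtree V m t 0 0)) p := by
    refine ⟨Or.inl rfl, ?_⟩
    rintro z (rfl | hz)
    · exact T.le_refl _
    · exact T.le_trans _ _ _ hpq (hq.2 z hz)
  obtain ⟨C, hC, -, hsum⟩ := (hasChain_subtree T β t m 0 0 (by omega) (by simp)).insert_min
    (Set.subset_insert p _) hmin (fun h => hst (eq_of_mem_subtree hp.1 h).1) le_rfl
  rw [← Finset.range_eq_Ico] at hsum
  have := TDDecomp.sum_le_weightedDepth (gadgetW β) hC
  have := le_gadgetW_of_mem_subtree β hp.1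
  omega

end Gadget

theorem TDDecomp.common_below_of_comp {W : Type*} {H : SimpleGraph W} {T : TDDecomp H}
    {p q x y : W} (hpq : ¬ T.le p q) (hqp : ¬ T.le q p) (hxy : T.Comp x y)
    (hx : T.Comp x p) (hy : T.Comp y q) :
    (T.le x p ∧ T.le x q) ∨ (T.le y p ∧ T.le y q) := by
  have tr := T.le_trans
  have key : ∀ {p q x y}, ¬ T.le p q → ¬ T.le q p → T.le x y → T.Comp x p → T.Comp y q →
      T.le x p ∧ T.le x q := by
    intro p q x y hpq hqp hxy hx hy
    have hxq : T.Comp x q := by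
      rcases hy with hy | hy
      · exact Or.inl (tr _ _ _ hxy hy)
      · exact T.down_linear _ _ _ hxy hy
    rcases hx with hx | hx <;> rcases hxq with hxq | hxq
    · exact ⟨hx, hxq⟩
    · exact absurd (tr _ _ _ hxq hx) hqp
    · exact absurd (tr _ _ _ hx hxq) hpq
    · rcases hy with hy | hy
      · exact absurd (tr _ _ _ hx (tr _ _ _ hxy hy)) hpq
      · exact (T.down_linear _ _ _ hx hxq).elim (absurd · hpq) (absurd · hqp)
  rcases hxy with h | h
  · exact Or.inl (key hpq hqp h hx hy)
  · exact Or.inr (key hqp hpq h hy hx).symm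

section Counting

open Finset

variable {V : Type*} [Fintype V] {m : ℕ} {G : SimpleGraph V}

theorem exists_cover_of_separator (P : GadgetV V m → Prop)
    (hc : ∀ u v, G.Adj u v → ∀ i j : Fin 2, i ≠ j → P (.copy u i) ∨ P (.copy v j))
    (hg : ∀ v (i : Fin 2) (j : Fin 3), i.castSucc ≠ j → P (.copy v i) ∨ P (.guard v j)) :
    ∃ C : Finset V, (∀ u v : V, G.Adj u v → u ∈ C ∨ v ∈ C) ∧
      3 * Fintype.card V + C.card ≤ ∑ v, localWeight P v := by
  classical
  have hlocal : ∀ v, 3 ≤ localWeight P v ∧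
      (localWeight P v < 4 → ¬ P (.copy v 0) ∧ ¬ P (.copy v 1)) := by
    intro v
    have h01 := hg v 0 1 (by decide)
    have h02 := hg v 0 2 (by decide)
    have h10 := hg v 1 0 (by decide)
    have h12 := hg v 1 2 (by decide)
    unfold localWeight
    split_ifs <;> simp_all
  refine ⟨univ.filter fun v => 4 ≤ localWeight P v, ?_, ?_⟩
  · intro u v huv
    by_contra! h
    simp only [Finset.mem_filter, Finset.mem_univ, true_and, not_le] at h
    rcases hc u v huv 0 1 (by decide) with h' | h'
    · exact ((hlocal u).2 h.1).1 h'
    · exact ((hlocal v).2 h.2).2 h'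
  · rw [Finset.card_filter, mul_comm, ← smul_eq_mul, ← Finset.card_univ, ← Finset.sum_const,
      ← Finset.sum_add_distrib]
    refine Finset.sum_le_sum fun v _ => ?_
    have := (hlocal v).1
    split_ifs <;> omega

/-- The counting argument: `D t` stands for the set of vertices below the least vertex of
`T_{t+1}`, and `D a ∩ D b` separates `T_{a+1}` from `T_{b+1}`. -/
theorem exists_cover_of_separators (k : ℕ) (hk : k < Fintype.card V - 1)
    (hnb : ∀ v, ∃ u, G.Adj v u) (D : Fin 3 → GadgetV V m → Prop)
    (htot : ∀ a b c, (∀ x, D a x → D b x → D c x) ∨ (∀ x, D a x → D c x → D b x))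
    (hcc : ∀ u v, G.Adj u v → ∀ i j : Fin 2, i ≠ j →
      (D i.castSucc (.copy u i) ∧ D j.castSucc (.copy u i)) ∨
      (D i.castSucc (.copy v j) ∧ D j.castSucc (.copy v j)))
    (hcg : ∀ v (i : Fin 2) (j : Fin 3), i.castSucc ≠ j →
      (D i.castSucc (.copy v i) ∧ D j (.copy v i)) ∨
      (D i.castSucc (.guard v j) ∧ D j (.guard v j)))
    (hW : ∀ a P, (∀ x, P x → D a x) →
      ∑ v, localWeight P v ≤ 3 * Fintype.card V + k + 2)
    (hWg : ∀ a P v, (∀ x, P x → D a x) → ¬ P (.guard v a) →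
      ∑ v, localWeight P v + 1 ≤ 3 * Fintype.card V + k + 2)
    (hWc : ∀ (i : Fin 2) P v, (∀ x, P x → D i.castSucc x) → ¬ P (.copy v i) →
      ∑ v, localWeight P v + 2 ≤ 3 * Fintype.card V + k + 2) :
    ∃ C : Finset V, (∀ u v : V, G.Adj u v → u ∈ C ∨ v ∈ C) ∧ C.card ≤ k := by
  have hsum : ∀ (P : GadgetV V m → Prop) (s : ℕ), (∀ v, s ≤ localWeight P v) →
      Fintype.card V * s ≤ ∑ v, localWeight P v := by
    intro P s hP
    rw [← smul_eq_mul, ← Finset.card_univ, ← Finset.sum_const]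
    exact Finset.sum_le_sum fun v _ => hP v
  have hsep : ∀ P : GadgetV V m → Prop,
      (∀ a b, a ≠ b → ∀ x, D a x → D b x → P x) →
      (∀ v (i : Fin 2) (j : Fin 3), i.castSucc ≠ j → P (.copy v i) ∨ P (.guard v j)) ∧
      ∃ C : Finset V, (∀ u v : V, G.Adj u v → u ∈ C ∨ v ∈ C) ∧
        3 * Fintype.card V + C.card ≤ ∑ v, localWeight P v := by
    intro P hP
    have hg : ∀ v (i : Fin 2) (j : Fin 3), i.castSucc ≠ j → P (.copy v i) ∨ P (.guard v j) :=
      fun v i j hij => (hcg v i j hij).imp (fun h => hP _ _ hij _ h.1 h.2)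
        (fun h => hP _ _ hij _ h.1 h.2)
    refine ⟨hg, exists_cover_of_separator P (fun u v huv i j hij => ?_) hg⟩
    have hij' : i.castSucc ≠ j.castSucc := fun h => hij (Fin.castSucc_injective _ h)
    exact (hcc u v huv i j hij).imp (fun h => hP _ _ hij' _ h.1 h.2)
      (fun h => hP _ _ hij' _ h.1 h.2)
  have hcopies : (∀ x, D 0 x → D 2 x → D 1 x) → (∀ x, D 1 x → D 2 x → D 0 x) →
      ∃ C : Finset V, (∀ u v : V, G.Adj u v → u ∈ C ∨ v ∈ C) ∧ C.card ≤ k := by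
    intro h02 h12
    set P : GadgetV V m → Prop := fun x => D 0 x ∧ D 1 x with hPdef
    obtain ⟨-, C, hC, hCcard⟩ := hsep P (by
      intro a b hab x
      have := h02 x
      have := h12 x
      fin_cases a <;> fin_cases b <;> simp_all)
    by_cases hex : ∃ v, ∃ i : Fin 2, ¬ P (.copy v i)
    · obtain ⟨v, i, hv⟩ := hex
      have := hWc i P v (by fin_cases i <;> simp +contextual [hPdef]) hv
      exact ⟨C, hC, by omega⟩
    · push Not at hex
      have h4 := hsum P 4 (fun v => by simp [localWeight, hex])
      have hg0 : ∀ v, P (.guard v 0) := by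
        intro v
        by_contra hv
        have := hWg 0 P v (fun x hx => hx.1) hv
        omega
      have h5 := hsum P 5 (fun v => by simp only [localWeight, hex, hg0, if_true]; omega)
      have := hW 0 P (fun x hx => hx.1)
      omega
  have hguard : ∀ i o : Fin 2, i ≠ o →
      (∀ x, D i.castSucc x → D o.castSucc x → D 2 x) →
      (∀ x, D o.castSucc x → D 2 x → D i.castSucc x) →
      ∃ C : Finset V, (∀ u v : V, G.Adj u v → u ∈ C ∨ v ∈ C) ∧ C.card ≤ k := by
    intro i o hio hio2 ho2i
    have hio' : i.castSucc ≠ o.castSucc := fun h => hio (Fin.castSucc_injective _ h)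
    have hne2 : ∀ j : Fin 2, j.castSucc ≠ 2 := by decide
    set P : GadgetV V m → Prop := fun x => D i.castSucc x ∧ D 2 x
    obtain ⟨hg, C, hC, hCcard⟩ := hsep P (by
      intro a b hab x ha hb
      have hcases : ∀ i o : Fin 2, i ≠ o → ∀ a : Fin 3,
          a = i.castSucc ∨ a = o.castSucc ∨ a = 2 := by decide
      rcases hcases i o hio a with rfl | rfl | rfl <;>
        rcases hcases i o hio b with rfl | rfl | rfl
      · exact absurd rfl hab
      · exact ⟨ha, hio2 x ha hb⟩
      · exact ⟨ha, hb⟩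
      · exact ⟨hb, hio2 x hb ha⟩
      · exact absurd rfl hab
      · exact ⟨ho2i x ha hb, hb⟩
      · exact ⟨hb, ha⟩
      · exact ⟨ho2i x hb ha, ha⟩
      · exact absurd rfl hab)
    have hlw : ∀ Q : GadgetV V m → Prop, ∀ v, Q (.copy v i) → Q (.guard v i.castSucc) →
        Q (.guard v 2) → 4 ≤ localWeight Q v ∧ (Q (.copy v o) → 5 ≤ localWeight Q v) := by
      intro Q v h1 h2 h3
      rw [localWeight_eq Q v hio, if_pos h1, if_pos h2, if_pos h3]
      refine ⟨by omega, fun h => ?_⟩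
      rw [if_pos h]
      omega
    by_cases hex : ∃ v, ¬ P (.copy v i)
    · obtain ⟨v, hv⟩ := hex
      have := hWc i P v (fun x hx => hx.1) hv
      exact ⟨C, hC, by omega⟩
    push Not at hex
    have h4 : Fintype.card V * 4 ≤ ∑ v, localWeight P v := by
      refine hsum P 4 fun v => ?_
      have h1 := hex v
      have h2 := hg v o i.castSucc hio'.symm
      have h3 := hg v o 2 (hne2 o)
      rw [localWeight_eq P v hio, if_pos h1]
      by_cases h : P (.copy v o)
      · rw [if_pos h]
        omega
      · rw [if_pos (h2.resolve_left h), if_pos (h3.resolve_left h)]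
        omega
    have hgi : ∀ v, P (.guard v i.castSucc) := by
      intro v
      by_contra hv
      have := hWg i.castSucc P v (fun x hx => hx.1) hv
      omega
    have hg2 : ∀ v, P (.guard v 2) := by
      intro v
      by_contra hv
      have := hWg 2 P v (fun x hx => hx.2) hv
      omega
    have hco : ∀ v, ¬ P (.copy v o) := by
      intro v hv
      have hlt : ∑ _v : V, 4 < ∑ v, localWeight P v :=
        Finset.sum_lt_sum (fun u _ => (hlw P u (hex u) (hgi u) (hg2 u)).1)
          ⟨v, Finset.mem_univ v, (hlw P v (hex v) (hgi v) (hg2 v)).2 hv⟩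
      rw [Finset.sum_const, Finset.card_univ, smul_eq_mul] at hlt
      have := hW 2 P (fun x hx => hx.2)
      omega
    have hDo : Fintype.card V * 4 ≤ ∑ v, localWeight (fun x => P x ∧ D o.castSucc x) v := by
      refine hsum _ 4 fun v => (hlw _ v ⟨hex v, ?_⟩ ⟨hgi v, ?_⟩ ⟨hg2 v, ?_⟩).1
      · obtain ⟨u, huv⟩ := hnb v
        rcases hcc v u huv i o hio with h | h
        · exact h.2
        · exact absurd ⟨h.1, hio2 _ h.1 h.2⟩ (hco u)
      · rcases hcg v o i.castSucc hio'.symm with h | h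
        · exact absurd ⟨h.2, hio2 _ h.2 h.1⟩ (hco v)
        · exact h.1
      · rcases hcg v o 2 (hne2 o) with h | h
        · exact absurd ⟨ho2i _ h.1 h.2, h.2⟩ (hco v)
        · exact h.1
    have hV : 0 < Fintype.card V := by omega
    obtain ⟨v⟩ := Fintype.card_pos_iff.1 hV
    have := hWc o (fun x => P x ∧ D o.castSucc x) v (fun x hx => hx.2) (fun h => hco v h.1)
    omega
  have swap : ∀ {a b c}, (∀ x, D a x → D b x → D c x) → ∀ x, D b x → D a x → D c x :=
    fun h x hb ha => h x ha hb
  rcases htot 0 1 2 with h1 | h1 <;> rcases htot 1 0 2 with h2 | h2 <;>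
    rcases htot 2 0 1 with h3 | h3
  · exact hguard 1 0 (by decide) h2 (swap h3)
  · exact hguard 0 1 (by decide) h1 (swap h3)
  · exact hguard 1 0 (by decide) (swap h1) (swap h3)
  · exact hguard 0 1 (by decide) h1 h2
  · exact hguard 1 0 (by decide) h2 h1
  · exact hcopies h1 (swap h3)
  · exact hcopies h1 h2
  · exact hcopies h1 h2

end Counting

/-- If the gadget graph `G'` (with weights given by `β = 3n + k + 3`,
`α = Σ_{i=0}^{m} (β + 3i)`, `k' = 3n + k + α + 2`) has a treedepth decomposition of
weighted depth at most `k'`, then the cubic graph `G` has a vertex cover of size at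
most `k`. -/
theorem stmt12 {V : Type*} [Fintype V] (G : SimpleGraph V) (m : ℕ) (hm : 1 ≤ m)
    (hcard : Fintype.card V = 2 ^ m) (e : V ≃ Fin (2 ^ m))
    (hdeg : ∀ v : V, (G.neighborSet v).ncard = 3)
    (k : ℕ) (hk1 : 1 < k) (hk2 : k < Fintype.card V - 1)
    (β α k' : ℕ)
    (hβ : β = 3 * Fintype.card V + k + 3)
    (hα : α = ∑ i ∈ Finset.range (m + 1), (β + 3 * i))
    (hk' : k' = 3 * Fintype.card V + k + α + 2)
    (hT : ∃ T : TDDecomp (gadget G e), T.weightedDepth (gadgetW β) ≤ k') :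
    ∃ C : Finset V, (∀ u v : V, G.Adj u v → u ∈ C ∨ v ∈ C) ∧ C.card ≤ k := by
  obtain ⟨T, hT⟩ := hT
  rw [hk', show 3 * Fintype.card V + k + α + 2 = 3 * Fintype.card V + k + 2 + α by ring] at hT
  have hmin : ∀ t, ∃ r, T.IsMin (subtree V m t 0 0) r :=
    fun t => exists_isMin_subtree T t m 0 0 (by omega) (by simp)
  choose r hr using hmin
  have hinc : ∀ a b, a ≠ b → ¬ T.le (r a) (r b) := fun a b hab =>
    not_le_of_isMin_subtree β hab (hr a) (hr b) (by rw [← hα]; omega)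
  have hcopy : ∀ v (i : Fin 2), T.Comp (.copy v i)
      (.tree i.castSucc ⟨m, by omega⟩ ⟨e v, (e v).isLt⟩) := fun v i =>
    T.adj_comparable _ _ (gadget_adj_of_rel (by simp) ⟨rfl, rfl, rfl⟩)
  have hguard : ∀ v (i : Fin 3), T.Comp (.guard v i)
      (.tree i ⟨m, by omega⟩ ⟨e v, (e v).isLt⟩) := fun v i =>
    T.adj_comparable _ _ (gadget_adj_of_rel (by simp) ⟨rfl, rfl, rfl⟩)
  have hcopy_r : ∀ v (i : Fin 2), T.Comp (.copy v i) (r i.castSucc) := fun v i =>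
    TDDecomp.comp_of_le_of_comp ((hr _).2 _ (tree_mem_subtree_zero _ _ _)) (hcopy v i)
  have hguard_r : ∀ v (i : Fin 3), T.Comp (.guard v i) (r i) := fun v i =>
    TDDecomp.comp_of_le_of_comp ((hr _).2 _ (tree_mem_subtree_zero _ _ _)) (hguard v i)
  refine exists_cover_of_separators k hk2 ?_ (fun a x => T.le x (r a)) ?_ ?_ ?_ ?_ ?_ ?_
  · intro v
    exact Set.nonempty_of_ncard_ne_zero (s := G.neighborSet v) (by rw [hdeg v]; decide)
  · intro a b c
    by_contra! h
    obtain ⟨⟨x, hxa, hxb, hxc⟩, y, hya, hyc, hyb⟩ := h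
    rcases T.down_linear _ _ _ hxa hya with h | h
    · exact hxc (T.le_trans _ _ _ h hyc)
    · exact hyb (T.le_trans _ _ _ h hxb)
  · intro u v huv i j hij
    have hij' : i.castSucc ≠ j.castSucc := fun h => hij (Fin.castSucc_injective _ h)
    refine TDDecomp.common_below_of_comp (hinc _ _ hij') (hinc _ _ hij'.symm) ?_ (hcopy_r u i)
      (hcopy_r v j)
    exact T.adj_comparable _ _ (gadget_adj_of_rel (by simp [hij]) huv)
  · intro v i j hij
    refine TDDecomp.common_below_of_comp (hinc _ _ hij) (hinc _ _ hij.symm) ?_ (hcopy_r v i)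
      (hguard_r v j)
    exact T.adj_comparable _ _ (gadget_adj_of_rel (by simp) rfl)
  · intro a P hP
    have := sum_localWeight_add_sum_le β (hr a) hP
    rw [← hα] at this
    omega
  · intro a P v hP hv
    have := sum_localWeight_add_sum_add_le β (hr a) hP (e v).isLt (by rintro ⟨_, _, h, -⟩; cases h)
      hv (by simp [gadgetW]) (hguard v a)
    rw [← hα] at this
    simp only [gadgetW] at this
    omega
  · intro i P v hP hv
    have := sum_localWeight_add_sum_add_le β (hr _) hP (e v).isLt (by rintro ⟨_, _, h, -⟩; cases h)
      hv (by simp [gadgetW]) (hcopy v i)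
    rw [← hα] at this
    simp only [gadgetW] at this
    omega
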